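/- arXiv:1609.04362 — 2 statements merged into one kernel-verified Lean document; each statement's English description precedes it below -/
import Mathlib

section
/- Let L be a partial group with product Π : D → L and let f, g ∈ L. Then the following are equivalent: (1) f ∈ C_L(g), i.e. g ∈ D(f) and g^f = g; (2) g ∈ C_L(f), i.e. f ∈ D(g) and f^g = f; (3) (f⁻¹,g⁻¹,f,g) ∈ D and Π(f⁻¹,g⁻¹,f,g) = 1; (4) (g⁻¹,f⁻¹,g,f) ∈ D and Π(g⁻¹,f⁻¹,g,f) = 1. Moreover, if f ∈ C_L(g) then (f,g) ∈ D, (g,f) ∈ D and Π(f,g) = Π(g,f). -/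
/-!
Background definitions for partial groups and localities in the sense of Chermak.

A *partial group* is given by `Data`: a domain `D` of words, a (total, but only
meaningful on `D`) product `pi : List L → L`, and an inversion map, subject to the
axioms collected in `IsPartialGroup`.
-/

namespace PartialGroups

/-- The underlying data of a partial group. -/
structure Data (L : Type*) where
  /-- The domain of the product, a set of words. -/
  D : Set (List L)
  /-- The product `Π`, meaningful on `D`. -/
  pi : List L → L
  /-- The inversion map. -/
  inv : L → L

variable {L L' L₁ L₂ L₁' L₂' : Type*}

/-- The formal inverse of a word: `(f₁,…,fₙ)⁻¹ = (fₙ⁻¹,…,f₁⁻¹)`. -/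
def Data.wInv (P : Data L) (w : List L) : List L := (w.map P.inv).reverse

/-- The identity element `1 = Π(∅)`. -/
def Data.one (P : Data L) : L := P.pi []

/-- The axioms of a partial group. -/
structure IsPartialGroup (P : Data L) : Prop where
  /-- Inversion is an involution (in particular a bijection). -/
  inv_inv : ∀ f : L, P.inv (P.inv f) = f
  /-- `L ⊆ D` (words of length one lie in the domain). -/
  singleton_mem : ∀ f : L, [f] ∈ P.D
  /-- `u ∘ v ∈ D` implies `u ∈ D`. -/
  append_left : ∀ u v : List L, u ++ v ∈ P.D → u ∈ P.D
  /-- `u ∘ v ∈ D` implies `v ∈ D`. -/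
  append_right : ∀ u v : List L, u ++ v ∈ P.D → v ∈ P.D
  /-- `Π` restricts to the identity on words of length one. -/
  pi_singleton : ∀ f : L, P.pi [f] = f
  /-- `u ∘ v ∘ w ∈ D` implies `u ∘ (Π(v)) ∘ w ∈ D`. -/
  assoc_mem : ∀ u v w : List L, u ++ v ++ w ∈ P.D → u ++ [P.pi v] ++ w ∈ P.D
  /-- `Π(u ∘ v ∘ w) = Π(u ∘ (Π(v)) ∘ w)`. -/
  assoc_pi : ∀ u v w : List L, u ++ v ++ w ∈ P.D →
    P.pi (u ++ v ++ w) = P.pi (u ++ [P.pi v] ++ w)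
  /-- `w ∈ D` implies `w⁻¹ ∘ w ∈ D`. -/
  wInv_mem : ∀ w ∈ P.D, P.wInv w ++ w ∈ P.D
  /-- `Π(w⁻¹ ∘ w) = 1`. -/
  wInv_pi : ∀ w ∈ P.D, P.pi (P.wInv w ++ w) = P.one

/-- `D(g)`: the set of `x` for which `x^g` is defined. -/
def Data.Dconj (P : Data L) (g : L) : Set L := {x | [P.inv g, x, g] ∈ P.D}

/-- Conjugation `x^g = Π(g⁻¹, x, g)`. -/
def Data.conj (P : Data L) (x g : L) : L := P.pi [P.inv g, x, g]

/-- `X^g = {x^g : x ∈ X}`. -/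
def Data.conjSet (P : Data L) (X : Set L) (g : L) : Set L := (fun x => P.conj x g) '' X

/-- `W(H)`: the set of words with all entries in `H`. -/
def Wrd (H : Set L) : Set (List L) := {w | ∀ x ∈ w, x ∈ H}

/-- The centralizer `C_L(X) = {g : x ∈ D(g) and x^g = x for all x ∈ X}`. -/
def Data.centralizer (P : Data L) (X : Set L) : Set L :=
  {g | ∀ x ∈ X, x ∈ P.Dconj g ∧ P.conj x g = x}

/-- The center `Z(L) = C_L(L)`. -/
def Data.center (P : Data L) : Set L := P.centralizer Set.univ

/-- The normalizer `N_L(X) = {g : X ⊆ D(g) and X^g = X}`. -/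
def Data.normalizer (P : Data L) (X : Set L) : Set L :=
  {g | X ⊆ P.Dconj g ∧ P.conjSet X g = X}

/-- The centralizer of `X` computed inside the partial subgroup `L₀`. -/
def Data.centralizerIn (P : Data L) (L₀ X : Set L) : Set L := L₀ ∩ P.centralizer X

/-- The center of the partial subgroup `L₀` (with its restricted partial product). -/
def Data.centerIn (P : Data L) (L₀ : Set L) : Set L := P.centralizerIn L₀ L₀

/-- The set product `XY = {Π(x,y) : x ∈ X, y ∈ Y, (x,y) ∈ D}`. -/
def Data.setMul (P : Data L) (X Y : Set L) : Set L :=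
  {z | ∃ x ∈ X, ∃ y ∈ Y, [x, y] ∈ P.D ∧ P.pi [x, y] = z}

/-- `S_g = {s ∈ S ∩ D(g) : s^g ∈ S}`. -/
def Data.SOf (P : Data L) (S : Set L) (g : L) : Set L :=
  {s | s ∈ S ∧ s ∈ P.Dconj g ∧ P.conj s g ∈ S}

/-- A partial subgroup: closed under inversion and under products of words in the domain. -/
def Data.IsPartialSubgroup (P : Data L) (H : Set L) : Prop :=
  (∀ f ∈ H, P.inv f ∈ H) ∧ ∀ w ∈ Wrd H ∩ P.D, P.pi w ∈ H

/-- A subgroup: a partial subgroup `H` with `W(H) ⊆ D`. -/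
def Data.IsSubgroup (P : Data L) (H : Set L) : Prop :=
  P.IsPartialSubgroup H ∧ Wrd H ⊆ P.D

/-- A `p`-subgroup: a subgroup whose order is a power of `p`. -/
def Data.IsPSubgroup (p : ℕ) (P : Data L) (H : Set L) : Prop :=
  P.IsSubgroup H ∧ ∃ n : ℕ, H.ncard = p ^ n

/-- A partial normal subgroup: `n^f ∈ N` for all `f ∈ L` and `n ∈ N ∩ D(f)`. -/
def Data.IsPartialNormal (P : Data L) (N : Set L) : Prop :=
  P.IsPartialSubgroup N ∧ ∀ f : L, ∀ n ∈ N, n ∈ P.Dconj f → P.conj n f ∈ N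

/-- A homomorphism of partial groups: `Dβ* ⊆ D'` and `Π'(vβ*) = (Π(v))β`. -/
def IsHom (P : Data L) (P' : Data L') (β : L → L') : Prop :=
  (∀ w ∈ P.D, w.map β ∈ P'.D) ∧ ∀ w ∈ P.D, P'.pi (w.map β) = β (P.pi w)

/-- A projection of partial groups: a homomorphism with `Dβ* = D'`. -/
def IsProjection (P : Data L) (P' : Data L') (β : L → L') : Prop :=
  IsHom P P' β ∧ ∀ w' ∈ P'.D, ∃ w ∈ P.D, w.map β = w'

/-- An isomorphism of partial groups: an injective projection. -/
def IsIsomorphism (P : Data L) (P' : Data L') (β : L → L') : Prop :=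
  IsProjection P P' β ∧ Function.Injective β

/-- The kernel `ker(β) = {f : fβ = 1'}`. -/
def pgKer (P : Data L) (P' : Data L') (β : L → L') : Set L := {f | β f = P'.one}

/-- `β` restricted to the partial subgroup `L₀` is a homomorphism of partial groups
(the source being `L₀` with the restricted product). -/
def IsHomBetween (P : Data L) (P' : Data L') (L₀ : Set L) (β : L → L') : Prop :=
  (∀ w ∈ P.D ∩ Wrd L₀, w.map β ∈ P'.D) ∧
    ∀ w ∈ P.D ∩ Wrd L₀, P'.pi (w.map β) = β (P.pi w)

/-- `β` restricted to a map `L₀ → L₀'` is a projection of partial groups between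
the restricted partial groups on `L₀` and `L₀'` (so `(D ∩ W(L₀))β* = D' ∩ W(L₀')`). -/
def IsProjBetween (P : Data L) (P' : Data L') (L₀ : Set L) (L₀' : Set L') (β : L → L') :
    Prop :=
  β '' L₀ = L₀' ∧ IsHomBetween P P' L₀ β ∧
    ∀ w' ∈ P'.D ∩ Wrd L₀', ∃ w ∈ P.D ∩ Wrd L₀, w.map β = w'

/-- `β` restricted to a map `L₀ → L₀'` is an isomorphism of partial groups. -/
def IsIsoBetween (P : Data L) (P' : Data L') (L₀ : Set L) (L₀' : Set L') (β : L → L') :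
    Prop :=
  IsProjBetween P P' L₀ L₀' β ∧ Set.InjOn β L₀

/-- `chainFrom P Δ w Q` means: the word `w` lies in `D_Δ` via the chain starting at
`P₀ = Q`, i.e. there are `P₀,…,Pₙ ∈ Δ` with `P_{i-1} ⊆ D(f_i)` and `P_{i-1}^{f_i} = P_i`. -/
def chainFrom (P : Data L) (Δ : Set (Set L)) : List L → Set L → Prop
  | [], _ => True
  | f :: w, Q => Q ⊆ P.Dconj f ∧ P.conjSet Q f ∈ Δ ∧ chainFrom P Δ w (P.conjSet Q f)

/-- The set of words `D_Δ`. -/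
def DDelta (P : Data L) (Δ : Set (Set L)) : Set (List L) :=
  {w | ∃ Q ∈ Δ, chainFrom P Δ w Q}

/-- `(L,Δ,S)` is a locality (for the prime `p`). -/
structure IsLocality (p : ℕ) (P : Data L) (Δ : Set (Set L)) (S : Set L) : Prop where
  isPartialGroup : IsPartialGroup P
  /-- `L` is finite as a set. -/
  finite : Finite L
  /-- `S` is a `p`-subgroup of `L`. -/
  pSubgroup : P.IsPSubgroup p S
  /-- `Δ` is nonempty. -/
  delta_nonempty : Δ.Nonempty
  /-- `Δ` is a set of subgroups of `S`. -/
  delta_subgroups : ∀ Q ∈ Δ, P.IsSubgroup Q ∧ Q ⊆ S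
  /-- (L1): `S` is maximal among the `p`-subgroups of `L`. -/
  s_maximal : ∀ T : Set L, P.IsPSubgroup p T → S ⊆ T → T = S
  /-- (L2): `D = D_Δ`. -/
  d_eq : P.D = DDelta P Δ
  /-- (L3): overgroups in `S` of conjugates of members of `Δ` lie in `Δ`. -/
  delta_closed : ∀ Q : Set L, P.IsSubgroup Q → Q ⊆ S →
    (∃ R ∈ Δ, ∃ g : L, R ⊆ P.Dconj g ∧ P.conjSet R g ⊆ Q) → Q ∈ Δ

/-- `(L₀,Δ,S)` is a locality, where `L₀` is a partial subgroup of the ambient partial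
group and `L₀` is regarded as a partial group with the restricted product.  All the
conditions are expressed via the ambient product (with which the restricted one
agrees on words in `W(L₀)`). -/
structure IsLocalityIn (p : ℕ) (P : Data L) (L₀ : Set L) (Δ : Set (Set L)) (S : Set L) :
    Prop where
  partialSubgroup : P.IsPartialSubgroup L₀
  /-- `L₀` is finite as a set. -/
  finite : L₀.Finite
  /-- `S` is a `p`-subgroup. -/
  pSubgroup : P.IsPSubgroup p S
  s_sub : S ⊆ L₀
  delta_nonempty : Δ.Nonempty
  delta_subgroups : ∀ Q ∈ Δ, P.IsSubgroup Q ∧ Q ⊆ S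
  /-- (L1) for the restriction. -/
  s_maximal : ∀ T : Set L, T ⊆ L₀ → P.IsPSubgroup p T → S ⊆ T → T = S
  /-- (L2) for the restriction. -/
  d_eq : ∀ w ∈ Wrd L₀, (w ∈ P.D ↔ w ∈ DDelta P Δ)
  /-- (L3) for the restriction. -/
  delta_closed : ∀ Q : Set L, P.IsSubgroup Q → Q ⊆ S →
    (∃ R ∈ Δ, ∃ g ∈ L₀, R ⊆ P.Dconj g ∧ P.conjSet R g ⊆ Q) → Q ∈ Δ

/-- `(L₀,Δ₀,S₀)` is a sublocality of a locality with Sylow subgroup `S`. -/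
def IsSubLocality (p : ℕ) (P : Data L) (S : Set L) (L₀ : Set L) (Δ₀ : Set (Set L))
    (S₀ : Set L) : Prop :=
  S₀ = S ∩ L₀ ∧ IsLocalityIn p P L₀ Δ₀ S₀

/-- A projection of localities: a projection of partial groups with `Δβ = Δ'`. -/
def IsLocalityProj (P : Data L) (P' : Data L') (Δ : Set (Set L)) (Δ' : Set (Set L'))
    (β : L → L') : Prop :=
  IsProjection P P' β ∧ Set.image β '' Δ = Δ'

/-- `β` restricted to `L₀ → L₀'` is a projection of localities. -/
def IsLocalityProjBetween (P : Data L) (P' : Data L') (L₀ : Set L) (Δ₀ : Set (Set L))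
    (L₀' : Set L') (Δ₀' : Set (Set L')) (β : L → L') : Prop :=
  IsProjBetween P P' L₀ L₀' β ∧ Set.image β '' Δ₀ = Δ₀'

/-- The right coset `Nf = {Π(n,f) : n ∈ N, (n,f) ∈ D}`. -/
def rightCoset (P : Data L) (N : Set L) (f : L) : Set L :=
  {y | ∃ n ∈ N, [n, f] ∈ P.D ∧ P.pi [n, f] = y}

/-- The data of the external direct product of two partial groups:  the domain consists
of the words whose words of first resp. second coordinates lie in the respective domains,
and the product and the inversion are computed coordinatewise. -/
def prodData (P₁ : Data L₁) (P₂ : Data L₂) : Data (L₁ × L₂) where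
  D := {u | u.map Prod.fst ∈ P₁.D ∧ u.map Prod.snd ∈ P₂.D}
  pi := fun u => (P₁.pi (u.map Prod.fst), P₂.pi (u.map Prod.snd))
  inv := fun f => (P₁.inv f.1, P₂.inv f.2)

/-- `Δ₁ * Δ₂`: the set of subgroups of `S₁ × S₂` containing some `P₁ × P₂` with
`P_i ∈ Δ_i`. -/
def deltaStar (P₁ : Data L₁) (P₂ : Data L₂) (Δ₁ : Set (Set L₁)) (Δ₂ : Set (Set L₂))
    (S₁ : Set L₁) (S₂ : Set L₂) : Set (Set (L₁ × L₂)) :=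
  {Q | (prodData P₁ P₂).IsSubgroup Q ∧ Q ⊆ S₁ ×ˢ S₂ ∧
    ∃ R₁ ∈ Δ₁, ∃ R₂ ∈ Δ₂, R₁ ×ˢ R₂ ⊆ Q}

/-- `K` is a normal `p`-subgroup of the subgroup `M` of the ambient partial group. -/
def Data.IsNormalPSubgroupIn (p : ℕ) (P : Data L) (M K : Set L) : Prop :=
  K ⊆ M ∧ P.IsSubgroup K ∧ (∃ n : ℕ, K.ncard = p ^ n) ∧
    ∀ f ∈ M, ∀ x ∈ K, x ∈ P.Dconj f ∧ P.conj x f ∈ K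

/-- `O_p(M)`: the largest normal `p`-subgroup of the subgroup `M` (the union of all
normal `p`-subgroups of `M`). -/
def Data.pCoreIn (p : ℕ) (P : Data L) (M : Set L) : Set L :=
  ⋃₀ {K | P.IsNormalPSubgroupIn p M K}

/-- The subgroup `M` of the ambient partial group is of characteristic `p`:
`C_M(O_p(M)) ≤ O_p(M)`. -/
def Data.IsCharPSubgroup (p : ℕ) (P : Data L) (M : Set L) : Prop :=
  P.centralizerIn M (P.pCoreIn p M) ⊆ P.pCoreIn p M

/-- A locality is of objective characteristic `p` if `N_L(Q)` is of characteristic `p`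
for every `Q ∈ Δ`. -/
def IsObjectiveCharP (p : ℕ) (P : Data L) (Δ : Set (Set L)) : Prop :=
  ∀ Q ∈ Δ, P.IsCharPSubgroup p (P.normalizer Q)

/-- The word `(Π(f₁,g₁),…,Π(fₙ,gₙ))` built from the words `u = (f₁,…,fₙ)` and
`v = (g₁,…,gₙ)`. -/
def zipProd (P : Data L) (u v : List L) : List L :=
  List.zipWith (fun f g => P.pi [f, g]) u v

/-- `L` is the internal central product of `M₁` and `M₂`: conditions (C1) and (C2). -/
def IsInternalCentralProduct (P : Data L) (M₁ M₂ : Set L) : Prop :=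
  (P.D = {w | ∃ u v : List L, u ∈ P.D ∩ Wrd M₁ ∧ v ∈ P.D ∩ Wrd M₂ ∧
      u.length = v.length ∧ (∀ q ∈ u.zip v, [q.1, q.2] ∈ P.D) ∧ w = zipProd P u v}) ∧
  ∀ u v : List L, u ∈ P.D ∩ Wrd M₁ → v ∈ P.D ∩ Wrd M₂ → u.length = v.length →
    (∀ q ∈ u.zip v, [q.1, q.2] ∈ P.D) →
    P.pi (zipProd P u v) = P.pi [P.pi u, P.pi v]

/-- `L` is the internal direct product of `M₁` and `M₂`: (C1), (C2) and (D). -/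
def IsInternalDirectProduct (P : Data L) (M₁ M₂ : Set L) : Prop :=
  IsInternalCentralProduct P M₁ M₂ ∧
    ∀ h : L, ∃! fg : L × L, fg.1 ∈ M₁ ∧ fg.2 ∈ M₂ ∧ [fg.1, fg.2] ∈ P.D ∧
      P.pi [fg.1, fg.2] = h

namespace IsPartialGroup

variable {P : Data L}

theorem pi_one_cons (hP : IsPartialGroup P) {w : List L} (hw : w ∈ P.D) :
    P.pi (P.one :: w) = P.pi w :=
  (hP.assoc_pi [] [] w hw).symm

theorem pi_mul_inv (hP : IsPartialGroup P) (f : L) : P.pi [f, P.inv f] = P.one := by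
  simpa [Data.wInv, hP.inv_inv] using hP.wInv_pi [P.inv f] (hP.singleton_mem _)

theorem pi_mul_inv_append (hP : IsPartialGroup P) {f : L} {w : List L}
    (hw : f :: P.inv f :: w ∈ P.D) : P.pi (f :: P.inv f :: w) = P.pi w := by
  have h := hP.assoc_pi [] [f, P.inv f] w hw
  rw [hP.pi_mul_inv] at h
  exact h.trans (hP.pi_one_cons (hP.append_right [f, P.inv f] w hw))

theorem inv_conj_word_append_mem (hP : IsPartialGroup P) {f g : L} (h : g ∈ P.Dconj f) :
    [P.inv f, P.inv g, f] ++ [P.inv f, g, f] ∈ P.D := by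
  simpa [Data.wInv, hP.inv_inv] using hP.wInv_mem _ h

theorem commutator_of_conj_eq (hP : IsPartialGroup P) {f g : L}
    (h : g ∈ P.Dconj f ∧ P.conj g f = g) :
    [P.inv f, P.inv g, f, g] ∈ P.D ∧ P.pi [P.inv f, P.inv g, f, g] = P.one := by
  obtain ⟨hD, hc⟩ := h
  have hw := hP.inv_conj_word_append_mem hD
  have hpi : P.pi ([P.inv f, P.inv g, f] ++ [P.inv f, g, f]) = P.one := by
    simpa [Data.wInv, hP.inv_inv] using hP.wInv_pi _ hD
  have hmem := hP.assoc_mem [P.inv f, P.inv g, f] [P.inv f, g, f] [] hw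
  have heq := hP.assoc_pi [P.inv f, P.inv g, f] [P.inv f, g, f] [] hw
  rw [show P.pi [P.inv f, g, f] = g from hc] at hmem heq
  exact ⟨hmem, heq.symm.trans hpi⟩

theorem conj_eq_of_commutator (hP : IsPartialGroup P) {f g : L}
    (h : [P.inv f, P.inv g, f, g] ∈ P.D ∧ P.pi [P.inv f, P.inv g, f, g] = P.one) :
    f ∈ P.Dconj g ∧ P.conj f g = f := by
  obtain ⟨hD, hc⟩ := h
  have hw : [f, P.inv f, P.inv g, f, g] ∈ P.D := by
    refine hP.append_right [P.inv g, P.inv f, g] _ ?_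
    simpa [Data.wInv, hP.inv_inv] using hP.wInv_mem _ hD
  have heq := hP.assoc_pi [f] [P.inv f, P.inv g, f, g] [] hw
  rw [hc] at heq
  have hone : P.pi [f, P.one] = f :=
    (hP.assoc_pi [f] [] [] (hP.singleton_mem f)).symm.trans (hP.pi_singleton f)
  exact ⟨hP.append_right [P.inv f] _ hD,
    (hP.pi_mul_inv_append hw).symm.trans (heq.trans hone)⟩

theorem commute_of_conj_eq (hP : IsPartialGroup P) {f g : L}
    (h : g ∈ P.Dconj f ∧ P.conj g f = g) :
    [f, g] ∈ P.D ∧ [g, f] ∈ P.D ∧ P.pi [f, g] = P.pi [g, f] := by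
  obtain ⟨hD, hc⟩ := h
  have hw : [f, P.inv f, g, f] ∈ P.D :=
    hP.append_right [P.inv f, P.inv g] _ (hP.inv_conj_word_append_mem hD)
  have hmem := hP.assoc_mem [f] [P.inv f, g, f] [] hw
  have heq := hP.assoc_pi [f] [P.inv f, g, f] [] hw
  rw [show P.pi [P.inv f, g, f] = g from hc] at hmem heq
  exact ⟨hmem, hP.append_right [P.inv f] _ hD, heq.symm.trans (hP.pi_mul_inv_append hw)⟩

end IsPartialGroup

/-- Lemma 3.3 (Centralizers): for `f, g ∈ L` the conditions (1) `f ∈ C_L(g)`,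
(2) `g ∈ C_L(f)`, (3) `(f⁻¹,g⁻¹,f,g) ∈ D` and `Π(f⁻¹,g⁻¹,f,g) = 1`, and
(4) `(g⁻¹,f⁻¹,g,f) ∈ D` and `Π(g⁻¹,f⁻¹,g,f) = 1` are equivalent; moreover if
`f ∈ C_L(g)` then `(f,g),(g,f) ∈ D` and `fg = gf`. -/
theorem centralizer_conditions (P : Data L) (hP : IsPartialGroup P) (f g : L) :
    ((g ∈ P.Dconj f ∧ P.conj g f = g) ↔ (f ∈ P.Dconj g ∧ P.conj f g = f)) ∧
    ((g ∈ P.Dconj f ∧ P.conj g f = g) ↔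
      ([P.inv f, P.inv g, f, g] ∈ P.D ∧ P.pi [P.inv f, P.inv g, f, g] = P.one)) ∧
    ((g ∈ P.Dconj f ∧ P.conj g f = g) ↔
      ([P.inv g, P.inv f, g, f] ∈ P.D ∧ P.pi [P.inv g, P.inv f, g, f] = P.one)) ∧
    ((g ∈ P.Dconj f ∧ P.conj g f = g) →
      [f, g] ∈ P.D ∧ [g, f] ∈ P.D ∧ P.pi [f, g] = P.pi [g, f]) :=
  have comm {a b : L} := hP.commutator_of_conj_eq (f := a) (g := b)
  have conj {a b : L} := hP.conj_eq_of_commutator (f := a) (g := b)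
  ⟨⟨fun h => conj (comm h), fun h => conj (comm h)⟩,
    ⟨comm, fun h => conj (comm (conj h))⟩,
    ⟨fun h => comm (conj (comm h)), conj⟩,
    hP.commute_of_conj_eq⟩

end PartialGroups
end

section
/- Let (L,Δ,S) be a locality with product Π : D → L, let L' be a partial group with product Π' : D' → L', and let β : L → L' be a projection of partial groups with N := ker(β) ⊆ Z(L). Then every right coset of N in L has exactly |N| elements and is therefore a maximal right coset. Moreover, for every word v ∈ W(L), one has v ∈ D if and only if vβ* ∈ D'. -/
/-!
Background definitions for partial groups and localities in the sense of Chermak.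

A *partial group* is given by `Data`: a domain `D` of words, a (total, but only
meaningful on `D`) product `pi : List L → L`, and an inversion map, subject to the
axioms collected in `IsPartialGroup`.
-/

namespace PartialGroups

variable {L L' L₁ L₂ L₁' L₂' : Type*}

namespace IsPartialGroup

variable {P : Data L}

theorem wInv_wInv (hP : IsPartialGroup P) (w : List L) : P.wInv (P.wInv w) = w := by
  simp [Data.wInv, Function.comp_def, hP.inv_inv]

theorem wInv_mem_D (hP : IsPartialGroup P) {w : List L} (hw : w ∈ P.D) : P.wInv w ∈ P.D :=
  hP.append_left _ _ (hP.wInv_mem w hw)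

theorem append_wInv_mem (hP : IsPartialGroup P) {w : List L} (hw : w ∈ P.D) :
    w ++ P.wInv w ∈ P.D := by
  simpa [hP.wInv_wInv] using hP.wInv_mem _ (hP.wInv_mem_D hw)

theorem append_wInv_pi (hP : IsPartialGroup P) {w : List L} (hw : w ∈ P.D) :
    P.pi (w ++ P.wInv w) = P.one := by
  simpa [hP.wInv_wInv] using hP.wInv_pi _ (hP.wInv_mem_D hw)

theorem pi_inv_mul (hP : IsPartialGroup P) (f : L) : P.pi [P.inv f, f] = P.one :=
  hP.wInv_pi _ (hP.singleton_mem f)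

theorem pi_append_one (hP : IsPartialGroup P) {w : List L} (hw : w ∈ P.D) :
    P.pi (w ++ [P.one]) = P.pi w := by
  simpa [Data.one] using (hP.assoc_pi w [] [] (by simpa using hw)).symm

theorem pi_one_mul (hP : IsPartialGroup P) (f : L) : P.pi [P.one, f] = f := by
  have := hP.assoc_pi [] [] [f] (hP.singleton_mem f)
  exact this.symm.trans (hP.pi_singleton f)

theorem pi_mul_one (hP : IsPartialGroup P) (f : L) : P.pi [f, P.one] = f := by
  rw [← hP.pi_singleton f]
  simpa [hP.pi_singleton] using hP.pi_append_one (hP.singleton_mem f)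

theorem cons_cons_inv_mem (hP : IsPartialGroup P) {a b : L} (h : [a, b] ∈ P.D) :
    [a, b, P.inv b] ∈ P.D :=
  hP.append_left [a, b, P.inv b] [P.inv a] (hP.append_wInv_mem h)

theorem pi_mul_mul_inv (hP : IsPartialGroup P) {a b : L} (h : [a, b] ∈ P.D) :
    P.pi [P.pi [a, b], P.inv b] = a := by
  have h3 := hP.cons_cons_inv_mem h
  have e1 := hP.assoc_pi [] [a, b] [P.inv b] h3
  have e2 := hP.assoc_pi [a] [b, P.inv b] [] h3
  simp only [List.nil_append, List.append_nil, List.cons_append] at e1 e2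
  rw [← e1, e2, hP.pi_mul_inv, hP.pi_mul_one]

theorem eq_inv_of_pi_eq_one (hP : IsPartialGroup P) {a b : L} (h : [a, b] ∈ P.D)
    (h1 : P.pi [a, b] = P.one) : a = P.inv b := by
  rw [← hP.pi_mul_mul_inv h, h1, hP.pi_one_mul]

theorem pi_wInv (hP : IsPartialGroup P) {w : List L} (hw : w ∈ P.D) :
    P.pi (P.wInv w) = P.inv (P.pi w) := by
  have h := hP.wInv_mem w hw
  have h1 : [] ++ P.wInv w ++ w ∈ P.D := by simpa using h
  have h2 := hP.assoc_mem [] (P.wInv w) w h1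
  have e2 := hP.assoc_pi [] (P.wInv w) w h1
  have h3 : [P.pi (P.wInv w)] ++ w ++ [] ∈ P.D := by simpa using h2
  have h4 := hP.assoc_mem _ w [] h3
  have e4 := hP.assoc_pi _ w [] h3
  refine hP.eq_inv_of_pi_eq_one h4 ?_
  simp only [List.nil_append, List.append_nil] at e2 e4
  exact (e4.symm.trans e2.symm).trans (hP.wInv_pi w hw)

/-- The word `(f, f⁻¹, x, f, f⁻¹)` lies in the domain whenever `x ∈ D(f)`. -/
theorem mem_of_mem_Dconj (hP : IsPartialGroup P) {x f : L} (h : x ∈ P.Dconj f) :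
    [f, P.inv f, x, f, P.inv f] ∈ P.D := by
  have h1 := hP.wInv_mem _ h
  have h2 : [f, P.inv f, x, f] ∈ P.D := by
    refine hP.append_right [P.inv f, P.inv x] _ ?_
    simpa [Data.wInv, hP.inv_inv] using h1
  have h3 := hP.append_wInv_mem h2
  refine hP.append_left _ [P.inv x, f, P.inv f] ?_
  simpa [Data.wInv, hP.inv_inv] using h3

theorem conj_mem_Dconj_inv (hP : IsPartialGroup P) {x f : L} (h : x ∈ P.Dconj f) :
    P.conj x f ∈ P.Dconj (P.inv f) := by
  have := hP.assoc_mem [f] [P.inv f, x, f] [P.inv f] (hP.mem_of_mem_Dconj h)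
  simpa [Data.Dconj, Data.conj, hP.inv_inv] using this

theorem conj_conj_inv (hP : IsPartialGroup P) {x f : L} (h : x ∈ P.Dconj f) :
    P.conj (P.conj x f) (P.inv f) = x := by
  have h5 := hP.mem_of_mem_Dconj h
  have e1 := hP.assoc_pi [f] [P.inv f, x, f] [P.inv f] h5
  have e2 := hP.assoc_pi [] [f, P.inv f] [x, f, P.inv f] h5
  have h6 := hP.assoc_mem [] [f, P.inv f] [x, f, P.inv f] h5
  have e3 := hP.assoc_pi [P.pi [f, P.inv f], x] [f, P.inv f] [] h6
  have h7 := hP.assoc_mem [P.pi [f, P.inv f], x] [f, P.inv f] [] h6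
  simp only [List.nil_append, List.append_nil, List.cons_append, hP.pi_mul_inv] at e1 e2 e3 h7
  rw [Data.conj, Data.conj, hP.inv_inv, ← e1, e2, e3]
  have h8 : [P.one, x] ∈ P.D := hP.append_left _ [P.one] h7
  have := hP.pi_append_one h8
  simp only [List.cons_append, List.nil_append] at this
  rw [this, hP.pi_one_mul]

end IsPartialGroup

/-- `Step P Δ A f B`: conjugation by `f` is defined on `A` and carries `A ∈ Δ` onto `B ∈ Δ`. -/
structure Step (P : Data L) (Δ : Set (Set L)) (A : Set L) (f : L) (B : Set L) : Prop where
  source_mem : A ∈ Δ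
  target_mem : B ∈ Δ
  subset : A ⊆ P.Dconj f
  conjSet_eq : P.conjSet A f = B

/-- `Chain P Δ A w B`: the word `w` carries `A` to `B` through members of `Δ`. -/
def Chain (P : Data L) (Δ : Set (Set L)) : Set L → List L → Set L → Prop
  | A, [], B => A ∈ Δ ∧ A = B
  | A, f :: w, B => ∃ C, Step P Δ A f C ∧ Chain P Δ C w B

namespace Step

variable {P : Data L} {Δ : Set (Set L)} {A B C : Set L} {f g : L}

theorem conj_mem (h : Step P Δ A f B) {x : L} (hx : x ∈ A) : P.conj x f ∈ B :=
  h.conjSet_eq ▸ ⟨x, hx, rfl⟩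

theorem symm (hP : IsPartialGroup P) (h : Step P Δ A f B) : Step P Δ B (P.inv f) A := by
  refine ⟨h.target_mem, h.source_mem, ?_, ?_⟩
  · rw [← h.conjSet_eq]
    rintro _ ⟨x, hx, rfl⟩
    exact hP.conj_mem_Dconj_inv (h.subset hx)
  · rw [← h.conjSet_eq]
    ext y
    constructor
    · rintro ⟨_, ⟨x, hx, rfl⟩, rfl⟩
      simpa [hP.conj_conj_inv (h.subset hx)] using hx
    · intro hy
      exact ⟨_, ⟨y, hy, rfl⟩, hP.conj_conj_inv (h.subset hy)⟩

theorem chain (h : Step P Δ A f B) : Chain P Δ A [f] B := ⟨B, h, h.target_mem, rfl⟩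

theorem of_mem_center (hA : A ∈ Δ) {n : L} (hn : n ∈ P.center) : Step P Δ A n A := by
  refine ⟨hA, hA, fun x _ => (hn x trivial).1, ?_⟩
  rw [Data.conjSet, Set.image_congr fun x _ => (hn x trivial).2, Set.image_id']

end Step

namespace Chain

variable {P : Data L} {Δ : Set (Set L)} {A B C : Set L} {u v w : List L}

theorem append (h : Chain P Δ A u B) (h' : Chain P Δ B v C) : Chain P Δ A (u ++ v) C := by
  induction u generalizing A with
  | nil => obtain ⟨_, rfl⟩ := h; exact h'
  | cons f u ih =>
    obtain ⟨E, hE, h⟩ := h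
    exact ⟨E, hE, ih h⟩

theorem symm (hP : IsPartialGroup P) (h : Chain P Δ A w B) : Chain P Δ B (P.wInv w) A := by
  induction w generalizing A with
  | nil => obtain ⟨h, rfl⟩ := h; exact ⟨h, rfl⟩
  | cons f w ih =>
    obtain ⟨E, hE, h⟩ := h
    have := (ih h).append (hE.symm hP).chain
    simpa [Data.wInv] using this

theorem source_mem (h : Chain P Δ A w B) : A ∈ Δ := by
  cases w with
  | nil => exact h.1
  | cons f w => obtain ⟨E, hE, h⟩ := h; exact hE.source_mem

theorem chainFrom (h : Chain P Δ A w B) : chainFrom P Δ w A := by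
  induction w generalizing A with
  | nil => trivial
  | cons f w ih =>
    obtain ⟨E, hE, h⟩ := h
    refine ⟨hE.subset, ?_, ?_⟩ <;> rw [hE.conjSet_eq]
    exacts [hE.target_mem, ih h]

end Chain

theorem exists_chain_of_chainFrom {P : Data L} {Δ : Set (Set L)} {A : Set L} {w : List L}
    (hA : A ∈ Δ) (h : chainFrom P Δ w A) : ∃ B, Chain P Δ A w B := by
  induction w generalizing A with
  | nil => exact ⟨A, hA, rfl⟩
  | cons f w ih =>
    obtain ⟨h1, h2, h3⟩ := h
    obtain ⟨B, hB⟩ := ih h2 h3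
    exact ⟨B, _, ⟨hA, h2, h1, rfl⟩, hB⟩

namespace IsPartialGroup

variable {P : Data L}

theorem pi_singleton_append (hP : IsPartialGroup P) {f : L} {w : List L} (h : f :: w ∈ P.D) :
    P.pi (f :: w) = P.pi [f, P.pi w] := by
  simpa using hP.assoc_pi [f] w [] (by simpa using h)

theorem pi_append_singleton (hP : IsPartialGroup P) {f : L} {w : List L} (h : w ++ [f] ∈ P.D) :
    P.pi (w ++ [f]) = P.pi [P.pi w, f] := by
  simpa using hP.assoc_pi [] w [f] (by simpa using h)

/-- Conjugation by `fg` is conjugation by `f` followed by conjugation by `g`. -/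
theorem conj_pi (hP : IsPartialGroup P) {x f g : L} (hfg : [f, g] ∈ P.D)
    (h : [P.inv g, P.inv f, x, f, g] ∈ P.D) :
    x ∈ P.Dconj (P.pi [f, g]) ∧ P.conj x (P.pi [f, g]) = P.conj (P.conj x f) g := by
  have hinv : P.pi [P.inv g, P.inv f] = P.inv (P.pi [f, g]) := hP.pi_wInv hfg
  have h1 := hP.assoc_mem [P.inv g, P.inv f, x] [f, g] [] h
  have e1 := hP.assoc_pi [P.inv g, P.inv f, x] [f, g] [] h
  have h2 := hP.assoc_mem [] [P.inv g, P.inv f] [x, P.pi [f, g]] h1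
  have e2 := hP.assoc_pi [] [P.inv g, P.inv f] [x, P.pi [f, g]] h1
  have e3 := hP.assoc_pi [P.inv g] [P.inv f, x, f] [g] h
  simp only [List.nil_append, List.append_nil, List.cons_append, hinv] at e1 e2 e3 h2
  exact ⟨h2, (e1.trans e2).symm.trans e3⟩

end IsPartialGroup

namespace IsLocality

variable {p : ℕ} {P : Data L} {Δ : Set (Set L)} {S A B C Q : Set L} {f g x : L} {w : List L}

theorem mem_D (h : IsLocality p P Δ S) (hw : Chain P Δ A w B) : w ∈ P.D := by
  rw [h.d_eq]
  exact ⟨A, hw.source_mem, hw.chainFrom⟩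

theorem exists_chain (h : IsLocality p P Δ S) (hw : w ∈ P.D) : ∃ A B, Chain P Δ A w B := by
  rw [h.d_eq] at hw
  obtain ⟨A, hA, hw⟩ := hw
  exact ⟨A, exists_chain_of_chainFrom hA hw⟩

theorem exists_step (h : IsLocality p P Δ S) (f : L) : ∃ A B, Step P Δ A f B := by
  obtain ⟨A, B, C, hf, -⟩ := h.exists_chain (h.isPartialGroup.singleton_mem f)
  exact ⟨A, C, hf⟩

theorem step_of_mem (h : IsLocality p P Δ S) (hA : A ∈ Δ) (hx : x ∈ A) : Step P Δ A x A := by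
  have hs := (h.delta_subgroups A hA).1
  have hi := hs.1.1 x hx
  have key : ∀ y ∈ A, ∀ z ∈ A, z ∈ P.Dconj y ∧ P.conj z y ∈ A := by
    intro y hy z hz
    have hw : [P.inv y, z, y] ∈ Wrd A := by
      have := hs.1.1 y hy
      simp [Wrd, hy, hz, this]
    exact ⟨hs.2 hw, hs.1.2 _ ⟨hw, hs.2 hw⟩⟩
  refine ⟨hA, hA, fun z hz => (key x hx z hz).1, Set.Subset.antisymm ?_ ?_⟩
  · rintro _ ⟨z, hz, rfl⟩
    exact (key x hx z hz).2
  · intro z hz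
    refine ⟨_, (key _ hi z hz).2, ?_⟩
    have := h.isPartialGroup.conj_conj_inv (key _ hi z hz).1
    rwa [h.isPartialGroup.inv_inv] at this

theorem conj_pi_of_step (h : IsLocality p P Δ S) (hf : Step P Δ A f B) (hg : Step P Δ B g C)
    (hx : Step P Δ A x A) :
    x ∈ P.Dconj (P.pi [f, g]) ∧ P.conj x (P.pi [f, g]) = P.conj (P.conj x f) g := by
  have hP := h.isPartialGroup
  have hfg := hf.chain.append hg.chain
  exact hP.conj_pi (h.mem_D hfg) (h.mem_D ((hfg.symm hP).append (hx.chain.append hfg)))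

theorem step_mul (h : IsLocality p P Δ S) (hf : Step P Δ A f B) (hg : Step P Δ B g C) :
    Step P Δ A (P.pi [f, g]) C := by
  have key := fun x hx => h.conj_pi_of_step hf hg (h.step_of_mem hf.source_mem (x := x) hx)
  refine ⟨hf.source_mem, hg.target_mem, fun x hx => (key x hx).1, ?_⟩
  rw [← hg.conjSet_eq, ← hf.conjSet_eq]
  simp only [Data.conjSet, Set.image_image]
  exact Set.image_congr fun x hx => (key x hx).2

theorem step_one (h : IsLocality p P Δ S) (hA : A ∈ Δ) : Step P Δ A P.one A := by
  refine h.step_of_mem hA ?_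
  have hs := (h.delta_subgroups A hA).1
  have hw : [] ∈ Wrd A := by simp [Wrd]
  exact hs.1.2 [] ⟨hw, hs.2 hw⟩

theorem step_pi (h : IsLocality p P Δ S) (hw : Chain P Δ A w B) : Step P Δ A (P.pi w) B := by
  induction w generalizing A with
  | nil => obtain ⟨hA, rfl⟩ := hw; exact h.step_one hA
  | cons f w ih =>
    rw [h.isPartialGroup.pi_singleton_append (h.mem_D hw)]
    obtain ⟨E, hE, hw⟩ := hw
    exact h.step_mul hE (ih hw)

theorem isSubgroup_S (h : IsLocality p P Δ S) : P.IsSubgroup S := h.pSubgroup.1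

theorem mem_delta_of_step (h : IsLocality p P Δ S) (hf : Step P Δ A f B) (hQ : P.IsSubgroup Q)
    (hQS : Q ⊆ S) (hBQ : B ⊆ Q) : Q ∈ Δ :=
  h.delta_closed Q hQ hQS ⟨A, hf.source_mem, f, hf.subset, hf.conjSet_eq ▸ hBQ⟩

theorem S_mem_delta (h : IsLocality p P Δ S) : S ∈ Δ := by
  obtain ⟨A, hA⟩ := h.delta_nonempty
  exact h.mem_delta_of_step (h.step_one hA) h.isSubgroup_S subset_rfl (h.delta_subgroups A hA).2

/-- The normalizer of a member `A` of `Δ`, regarded as a type. -/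
@[ext]
structure Normalizer (h : IsLocality p P Δ S) (A : Δ) where
  /-- The underlying element of the locality. -/
  val : L
  step : Step P Δ A val A

theorem pi_pi_left (h : IsLocality p P Δ S) {a b c : L} {E F : Set L} (ha : Step P Δ A a E)
    (hb : Step P Δ E b F) (hc : Step P Δ F c C) :
    P.pi [P.pi [a, b], c] = P.pi [a, P.pi [b, c]] := by
  have hm := h.mem_D (ha.chain.append (hb.chain.append hc.chain))
  exact (h.isPartialGroup.pi_append_singleton (w := [a, b]) hm).symm.trans
    (h.isPartialGroup.pi_singleton_append hm)

end IsLocality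

namespace IsLocality.Normalizer

variable {p : ℕ} {P : Data L} {Δ : Set (Set L)} {S : Set L} {h : IsLocality p P Δ S} {A B : Δ}

noncomputable instance : Mul (h.Normalizer A) := ⟨fun a b => ⟨P.pi [a.1, b.1], h.step_mul a.2 b.2⟩⟩

noncomputable instance : One (h.Normalizer A) := ⟨⟨P.one, h.step_one A.2⟩⟩

noncomputable instance : Inv (h.Normalizer A) := ⟨fun a => ⟨P.inv a.1, a.2.symm h.isPartialGroup⟩⟩

noncomputable instance : Group (h.Normalizer A) :=
  Group.ofLeftAxioms (fun a b c => Normalizer.ext (h.pi_pi_left a.2 b.2 c.2))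
    (fun a => Normalizer.ext (h.isPartialGroup.pi_one_mul a.1))
    (fun a => Normalizer.ext (h.isPartialGroup.pi_inv_mul a.1))

theorem val_injective : Function.Injective (val : h.Normalizer A → L) :=
  fun _ _ => Normalizer.ext

instance : Finite (h.Normalizer A) :=
  have := h.finite
  Finite.of_injective val val_injective

@[simp] theorem val_mul (a b : h.Normalizer A) : (a * b).1 = P.pi [a.1, b.1] := rfl

@[simp] theorem val_one : (1 : h.Normalizer A).1 = P.one := rfl

@[simp] theorem val_inv (a : h.Normalizer A) : (a⁻¹).1 = P.inv a.1 := rfl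

theorem chain_map (l : List (h.Normalizer A)) : Chain P Δ A (l.map val) A := by
  induction l with
  | nil => exact ⟨A.2, rfl⟩
  | cons a l ih => exact ⟨A, a.2, ih⟩

theorem val_prod (l : List (h.Normalizer A)) : l.prod.1 = P.pi (l.map val) := by
  induction l with
  | nil => rfl
  | cons a l ih =>
    rw [List.prod_cons, val_mul, ih, List.map_cons]
    exact (h.isPartialGroup.pi_singleton_append (h.mem_D (chain_map (a :: l)))).symm

theorem val_pow (a : h.Normalizer A) (k : ℕ) : (a ^ k).1 = P.pi (List.replicate k a.1) := by
  rw [← List.prod_replicate, val_prod, List.map_replicate]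

theorem pow_eq_one_of_val_eq {a : h.Normalizer A} {b : h.Normalizer B} (hab : a.1 = b.1) {k : ℕ}
    (ha : a ^ k = 1) : b ^ k = 1 := by
  refine Normalizer.ext ?_
  rw [val_pow, ← hab, ← val_pow, ha]
  rfl

theorem val_conj (a b : h.Normalizer A) : (b⁻¹ * a * b).1 = P.conj a.1 b.1 := by
  have := val_prod [b⁻¹, a, b]
  simpa [mul_assoc, Data.conj] using this

/-- The elements of the subgroup `H` of the locality normalizing `A`. -/
def ofIsSubgroup (h : IsLocality p P Δ S) (A : Δ) {H : Set L} (hH : P.IsSubgroup H) :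
    Subgroup (h.Normalizer A) where
  carrier := {a | a.1 ∈ H}
  mul_mem' {a b} ha hb := by
    have hw : [a.1, b.1] ∈ Wrd H := by
      simpa [Wrd] using And.intro ha hb
    exact hH.1.2 _ ⟨hw, hH.2 hw⟩
  one_mem' := by
    have hw : [] ∈ Wrd H := by simp [Wrd]
    exact hH.1.2 [] ⟨hw, hH.2 hw⟩
  inv_mem' ha := hH.1.1 _ ha

@[simp] theorem mem_ofIsSubgroup {H : Set L} {hH : P.IsSubgroup H} {a : h.Normalizer A} :
    a ∈ ofIsSubgroup h A hH ↔ a.1 ∈ H := Iff.rfl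

theorem isSubgroup_image (H : Subgroup (h.Normalizer A)) :
    P.IsSubgroup (val '' (H : Set (h.Normalizer A))) := by
  have key : ∀ w ∈ Wrd (val '' (H : Set (h.Normalizer A))),
      ∃ l : List (h.Normalizer A), (∀ a ∈ l, a ∈ H) ∧ l.map val = w := by
    intro w hw
    induction w with
    | nil => exact ⟨[], by simp, rfl⟩
    | cons x w ih =>
      obtain ⟨l, hl, rfl⟩ := ih fun y hy => hw y (List.mem_cons_of_mem _ hy)
      obtain ⟨a, ha, rfl⟩ := hw x List.mem_cons_self
      exact ⟨a :: l, List.forall_mem_cons.2 ⟨ha, hl⟩, rfl⟩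
  refine ⟨⟨?_, ?_⟩, ?_⟩
  · rintro _ ⟨a, ha, rfl⟩
    exact ⟨a⁻¹, H.inv_mem ha, rfl⟩
  · rintro w ⟨hw, -⟩
    obtain ⟨l, hl, rfl⟩ := key w hw
    exact ⟨l.prod, H.list_prod_mem hl, val_prod l⟩
  · intro w hw
    obtain ⟨l, hl, rfl⟩ := key w hw
    exact h.mem_D (chain_map l)

/-- Conjugation by `f` as a homomorphism between normalizers of members of `Δ`. -/
noncomputable def conjHom {f : L} (hf : Step P Δ A f B) : h.Normalizer A →* h.Normalizer B where
  toFun a := ⟨P.conj a.1 f,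
    h.step_pi ((hf.symm h.isPartialGroup).chain.append (a.2.chain.append hf.chain))⟩
  map_one' := by
    refine Normalizer.ext ?_
    have hfi := hf.symm h.isPartialGroup
    have := h.mem_D (hfi.chain.append ((h.step_one A.2).chain.append hf.chain))
    refine (h.isPartialGroup.pi_singleton_append this).trans ?_
    change P.pi [_, P.pi [_, _]] = _
    rw [h.isPartialGroup.pi_one_mul, h.isPartialGroup.pi_inv_mul]
    rfl
  map_mul' a b := by
    have hP := h.isPartialGroup
    refine Normalizer.ext ?_
    have hfi := hf.symm hP
    have h1 : [P.inv f, a.1, f, P.inv f, b.1, f] ∈ P.D :=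
      h.mem_D (hfi.chain.append (a.2.chain.append (hf.chain.append
        (hfi.chain.append (b.2.chain.append hf.chain)))))
    have h2 := hP.assoc_mem [] [P.inv f, a.1, f] [P.inv f, b.1, f] h1
    have e1 := hP.assoc_pi [] [P.inv f, a.1, f] [P.inv f, b.1, f] h1
    have e2 := hP.assoc_pi [P.pi [P.inv f, a.1, f]] [P.inv f, b.1, f] [] h2
    have h3 := hP.assoc_mem [P.inv f, a.1] [f, P.inv f] [b.1, f] h1
    have e3 := hP.assoc_pi [P.inv f, a.1] [f, P.inv f] [b.1, f] h1
    have e4 := hP.assoc_pi [P.inv f] [a.1, P.pi [f, P.inv f]] [b.1, f] h3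
    have h4 := hP.assoc_mem [P.inv f] [a.1, P.pi [f, P.inv f]] [b.1, f] h3
    have e5 := hP.assoc_pi [P.inv f] [P.pi [a.1, P.pi [f, P.inv f]], b.1] [f] h4
    simp only [List.nil_append, List.append_nil, List.cons_append, hP.pi_mul_inv,
      hP.pi_mul_one] at e1 e2 e3 e4 e5
    change P.pi [_, P.pi [a.1, b.1], _] = P.pi [P.pi [_, _, _], P.pi [_, _, _]]
    rw [← e2, ← e1, e3, e4, e5]

theorem isPGroup_ofIsSubgroup [Fact p.Prime] :
    IsPGroup p (ofIsSubgroup h ⟨S, h.S_mem_delta⟩ h.isSubgroup_S) := by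
  obtain ⟨n, hn⟩ := h.pSubgroup.2
  refine IsPGroup.iff_card.2 ⟨n, ?_⟩
  rw [← hn, ← Nat.card_coe_set_eq]
  exact Nat.card_congr ⟨fun a => ⟨a.1.1, a.2⟩,
    fun s => ⟨⟨s.1, h.step_of_mem h.S_mem_delta s.2⟩, s.2⟩, fun _ => rfl, fun _ => rfl⟩

theorem normal_ofIsSubgroup : (ofIsSubgroup h ⟨S, h.S_mem_delta⟩ h.isSubgroup_S).Normal := by
  refine ⟨fun n hn g => ?_⟩
  have := val_conj n g⁻¹
  rw [inv_inv] at this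
  rw [mem_ofIsSubgroup, this]
  exact g⁻¹.2.conj_mem hn

/-- Every `p`-element normalizing `S` lies in `S`. -/
theorem mem_of_pow_eq_one [Fact p.Prime] (y : h.Normalizer ⟨S, h.S_mem_delta⟩) {k : ℕ}
    (hy : y ^ p ^ k = 1) : y.1 ∈ S := by
  let H := ofIsSubgroup h ⟨S, h.S_mem_delta⟩ h.isSubgroup_S
  have hnormal : H.Normal := normal_ofIsSubgroup
  have hz : IsPGroup p (Subgroup.zpowers y) := by
    obtain ⟨j, -, hj⟩ := (Nat.dvd_prime_pow Fact.out).1 (orderOf_dvd_of_pow_eq_one hy)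
    exact IsPGroup.of_card (n := j) (by rw [Nat.card_zpowers, hj])
  have hsup : IsPGroup p (H ⊔ Subgroup.zpowers y : Subgroup _) :=
    isPGroup_ofIsSubgroup.to_sup_of_normal_left hz
  obtain ⟨n, hn⟩ := IsPGroup.iff_card.1 hsup
  have hle : S ⊆ val '' ((H ⊔ Subgroup.zpowers y : Subgroup _) :
      Set (h.Normalizer ⟨S, h.S_mem_delta⟩)) := fun s hs =>
    ⟨⟨s, h.step_of_mem h.S_mem_delta hs⟩, Subgroup.mem_sup_left hs, rfl⟩
  have heq := h.s_maximal _ ⟨isSubgroup_image _, n, by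
    rw [Set.ncard_image_of_injective _ val_injective, ← hn]; rfl⟩ hle
  exact heq.subset ⟨y, Subgroup.mem_sup_right (Subgroup.mem_zpowers y), rfl⟩

end IsLocality.Normalizer

/-- In a finite `p`-group every proper subgroup is properly contained in its normalizer. -/
theorem exists_mem_normalizer_of_isPGroup {G : Type*} [Group G] [Finite G] {p : ℕ}
    [Fact p.Prime] {A R : Subgroup G} (hR : IsPGroup p R) (hA : A < R) :
    ∃ x ∈ R, x ∉ A ∧ x ∈ Subgroup.normalizer (A : Set G) := by
  have : Group.IsNilpotent R := hR.isNilpotent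
  have hlt : A.subgroupOf R < ⊤ := by
    rw [lt_top_iff_ne_top, Ne, Subgroup.subgroupOf_eq_top]
    exact hA.not_ge
  obtain ⟨x, hx, hxA⟩ := SetLike.exists_of_lt (Group.normalizerCondition_of_isNilpotent _ hlt)
  refine ⟨x, x.2, fun h => hxA h, ?_⟩
  rw [Subgroup.mem_normalizer_iff] at hx ⊢
  intro a
  constructor
  · intro ha
    exact (hx ⟨a, hA.le ha⟩).1 ha
  · intro ha
    have haR : a ∈ R := by
      have := R.mul_mem (R.mul_mem (R.inv_mem x.2) (hA.le ha)) x.2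
      simpa [mul_assoc] using this
    exact (hx ⟨a, haR⟩).2 ha

namespace IsHom

variable {P : Data L} {P' : Data L'} {β : L → L'}

theorem map_mul (hβ : IsHom P P' β) {a b : L} (h : [a, b] ∈ P.D) :
    β (P.pi [a, b]) = P'.pi [β a, β b] :=
  (hβ.2 [a, b] h).symm

theorem map_mul_congr (hβ : IsHom P P' β) {a b c d : L} (h : [a, b] ∈ P.D) (h' : [c, d] ∈ P.D)
    (hac : β a = β c) (hbd : β b = β d) : β (P.pi [a, b]) = β (P.pi [c, d]) := by
  rw [hβ.map_mul h, hβ.map_mul h', hac, hbd]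

theorem map_one (hβ : IsHom P P' β) (h : [] ∈ P.D) : β P.one = P'.one :=
  (hβ.2 [] h).symm

end IsHom

namespace IsLocality

variable {p : ℕ} {P : Data L} {Δ : Set (Set L)} {S A B C : Set L} {f g x s t : L}

theorem isSubgroup_conjSet (h : IsLocality p P Δ S) (hf : Step P Δ B f C) (hA : P.IsSubgroup A)
    (hAB : A ⊆ B) : P.IsSubgroup (P.conjSet A f) := by
  have hf' : Step P Δ (⟨B, hf.source_mem⟩ : Δ) f (⟨C, hf.target_mem⟩ : Δ) := hf
  convert Normalizer.isSubgroup_image ((Normalizer.ofIsSubgroup h _ hA).map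
    (Normalizer.conjHom (h := h) hf')) using 1
  ext y
  constructor
  · rintro ⟨a, ha, rfl⟩
    exact ⟨_, ⟨⟨a, h.step_of_mem hf.source_mem (hAB ha)⟩, ha, rfl⟩, rfl⟩
  · rintro ⟨_, ⟨a, ha, rfl⟩, rfl⟩
    exact ⟨a.val, ha, rfl⟩

theorem step_conjSet (h : IsLocality p P Δ S) (hA : A ∈ Δ) (hs : s ∈ S) :
    Step P Δ A s (P.conjSet A s) := by
  have hS := h.step_of_mem h.S_mem_delta hs
  have hAs := h.delta_subgroups A hA
  refine ⟨hA, ?_, hAs.2.trans hS.subset, rfl⟩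
  refine h.delta_closed _ (h.isSubgroup_conjSet hS hAs.1 hAs.2) ?_
    ⟨A, hA, s, hAs.2.trans hS.subset, subset_rfl⟩
  rintro _ ⟨a, ha, rfl⟩
  exact hS.conj_mem (hAs.2 ha)

theorem inv_mem_S (h : IsLocality p P Δ S) (hs : s ∈ S) : P.inv s ∈ S :=
  h.isSubgroup_S.1.1 s hs

theorem exists_step_target (h : IsLocality p P Δ S) (hA : A ∈ Δ) (hs : s ∈ S) :
    ∃ B, Step P Δ B s A := by
  have := (h.step_conjSet hA (h.inv_mem_S hs)).symm h.isPartialGroup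
  rw [h.isPartialGroup.inv_inv] at this
  exact ⟨_, this⟩

theorem mul_S_mem (h : IsLocality p P Δ S) (g : L) (hs : s ∈ S) : [g, s] ∈ P.D := by
  obtain ⟨A, B, hg⟩ := h.exists_step g
  exact h.mem_D (hg.chain.append (h.step_conjSet hg.target_mem hs).chain)

theorem S_mul_mem (h : IsLocality p P Δ S) (g : L) (hs : s ∈ S) : [s, g] ∈ P.D := by
  obtain ⟨A, B, hg⟩ := h.exists_step g
  obtain ⟨C, hC⟩ := h.exists_step_target hg.source_mem hs
  exact h.mem_D (hC.chain.append hg.chain)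

theorem assoc_S_S_right (h : IsLocality p P Δ S) (g : L) (hs : s ∈ S) (ht : t ∈ S) :
    P.pi [P.pi [g, s], t] = P.pi [g, P.pi [s, t]] := by
  obtain ⟨A, B, hg⟩ := h.exists_step g
  have h1 := h.step_conjSet hg.target_mem hs
  exact h.pi_pi_left hg h1 (h.step_conjSet h1.target_mem ht)

theorem assoc_S_S_left (h : IsLocality p P Δ S) (g : L) (hs : s ∈ S) (ht : t ∈ S) :
    P.pi [P.pi [s, t], g] = P.pi [s, P.pi [t, g]] := by
  obtain ⟨A, B, hg⟩ := h.exists_step g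
  obtain ⟨C, h1⟩ := h.exists_step_target hg.source_mem ht
  obtain ⟨E, h2⟩ := h.exists_step_target h1.source_mem hs
  exact h.pi_pi_left h2 h1 hg

theorem assoc_S_mid_S (h : IsLocality p P Δ S) (g : L) (hs : s ∈ S) (ht : t ∈ S) :
    P.pi [P.pi [s, g], t] = P.pi [s, P.pi [g, t]] := by
  obtain ⟨A, B, hg⟩ := h.exists_step g
  obtain ⟨C, h1⟩ := h.exists_step_target hg.source_mem hs
  exact h.pi_pi_left h1 hg (h.step_conjSet hg.target_mem ht)

theorem mul_mem_S (h : IsLocality p P Δ S) (hs : s ∈ S) (ht : t ∈ S) : P.pi [s, t] ∈ S :=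
  h.isSubgroup_S.1.2 _ ⟨by simpa [Wrd] using And.intro hs ht, h.mul_S_mem s ht⟩

theorem one_mem_S (h : IsLocality p P Δ S) : P.one ∈ S :=
  h.isSubgroup_S.1.2 [] ⟨by simp [Wrd], h.isPartialGroup.append_left [] [P.one]
    (h.isPartialGroup.singleton_mem _)⟩

theorem mul_conj (h : IsLocality p P Δ S) (hf : Step P Δ A f B) (hx : x ∈ A) :
    P.pi [f, P.conj x f] = P.pi [x, f] := by
  have hP := h.isPartialGroup
  have hx' := h.step_of_mem hf.source_mem hx
  have hm : [f, P.inv f, x, f] ∈ P.D := h.mem_D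
    (hf.chain.append ((hf.symm hP).chain.append (hx'.chain.append hf.chain)))
  have e1 := hP.pi_singleton_append hm
  have e2 := hP.assoc_pi [] [f, P.inv f] [x, f] hm
  have hm2 := hP.assoc_mem [] [f, P.inv f] [x, f] hm
  simp only [List.nil_append, List.cons_append, hP.pi_mul_inv] at e2 hm2
  rw [Data.conj, ← e1, e2, hP.pi_singleton_append hm2, hP.pi_one_mul]

section Fiber

variable {P' : Data L'} {β : L → L'}

/-- The elements `x` of `S` for which `xf` and `fy` have the same image for some `y ∈ S`. -/
def fiberStabilizer (h : IsLocality p P Δ S) (hβ : IsHom P P' β) (f : L) :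
    Subgroup (h.Normalizer ⟨S, h.S_mem_delta⟩) where
  carrier := {x | x.val ∈ S ∧ ∃ y ∈ S, β (P.pi [x.val, f]) = β (P.pi [f, y])}
  mul_mem' := by
    rintro a b ⟨ha, y, hy, e⟩ ⟨hb, z, hz, e'⟩
    refine ⟨h.mul_mem_S ha hb, P.pi [y, z], h.mul_mem_S hy hz, ?_⟩
    rw [Normalizer.val_mul, h.assoc_S_S_left f ha hb,
      hβ.map_mul_congr (h.S_mul_mem _ ha) (h.S_mul_mem _ ha) rfl e', ← h.assoc_S_mid_S f ha hz,
      hβ.map_mul_congr (h.mul_S_mem _ hz) (h.mul_S_mem _ hz) e rfl, h.assoc_S_S_right f hy hz]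
  one_mem' := ⟨h.one_mem_S, P.one, h.one_mem_S, by
    rw [Normalizer.val_one, h.isPartialGroup.pi_one_mul, h.isPartialGroup.pi_mul_one]⟩
  inv_mem' := by
    have hP := h.isPartialGroup
    rintro a ⟨ha, y, hy, e⟩
    have hai := h.inv_mem_S ha
    have hyi := h.inv_mem_S hy
    refine ⟨hai, P.inv y, hyi, ?_⟩
    rw [Normalizer.val_inv]
    calc β (P.pi [P.inv a.val, f])
        = β (P.pi [P.inv a.val, P.pi [P.pi [f, y], P.inv y]]) := by
          rw [h.assoc_S_S_right f hy hyi, hP.pi_mul_inv, hP.pi_mul_one]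
      _ = β (P.pi [P.inv a.val, P.pi [P.pi [a.val, f], P.inv y]]) :=
          hβ.map_mul_congr (h.S_mul_mem _ hai) (h.S_mul_mem _ hai) rfl
            (hβ.map_mul_congr (h.mul_S_mem _ hyi) (h.mul_S_mem _ hyi) e.symm rfl)
      _ = β (P.pi [f, P.inv y]) := by
          rw [← h.assoc_S_mid_S _ hai hyi, ← h.assoc_S_S_left f hai ha, hP.pi_inv_mul,
            hP.pi_one_mul]

theorem fiberStabilizer_congr (h : IsLocality p P Δ S) (hβ : IsHom P P' β) (hfg : β f = β g) :
    h.fiberStabilizer hβ f = h.fiberStabilizer hβ g := by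
  ext x
  refine and_congr_right fun hx => exists_congr fun y => and_congr_right fun hy => ?_
  rw [hβ.map_mul_congr (h.S_mul_mem f hx) (h.S_mul_mem g hx) rfl hfg,
    hβ.map_mul_congr (h.mul_S_mem f hy) (h.mul_S_mem g hy) hfg rfl]

theorem mem_fiberStabilizer_of_step (h : IsLocality p P Δ S) (hβ : IsHom P P' β)
    (hf : Step P Δ A f B) {x : h.Normalizer ⟨S, h.S_mem_delta⟩} (hx : x.val ∈ A) :
    x ∈ h.fiberStabilizer hβ f :=
  ⟨(h.delta_subgroups A hf.source_mem).2 hx, P.conj x.val f,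
    (h.delta_subgroups B hf.target_mem).2 (hf.conj_mem hx), by rw [h.mul_conj hf hx]⟩

/-- If `xf` and `fs` have the same image, then so do `x ^ f` and `s`. -/
theorem map_conj_eq (h : IsLocality p P Δ S) (hβ : IsHom P P' β) (hf : Step P Δ A f B)
    (hx : Step P Δ A x A) (hs : s ∈ S) (e : β (P.pi [x, f]) = β (P.pi [f, s])) :
    β (P.conj x f) = β s := by
  have hP := h.isPartialGroup
  have hfi := hf.symm hP
  have hs' := h.step_conjSet hf.target_mem hs
  have h1 := h.mem_D (hfi.chain.append (hx.chain.append hf.chain))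
  have h2 := h.mem_D (hfi.chain.append (h.step_mul hx hf).chain)
  have h3 := h.mem_D (hfi.chain.append (h.step_mul hf hs').chain)
  have e1 : P.conj x f = P.pi [P.inv f, P.pi [x, f]] := hP.pi_singleton_append h1
  rw [e1, hβ.map_mul_congr h2 h3 rfl e, ← h.pi_pi_left hfi hf hs', hP.pi_inv_mul, hP.pi_one_mul]

theorem step_S_of_map_eq (h : IsLocality p P Δ S) (hβ : IsHom P P' β)
    (hker : pgKer P P' β ⊆ P.center) {y : L} (hs : s ∈ S) (e : β y = β s) : Step P Δ S y S := by
  have hP := h.isPartialGroup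
  have hsi := h.inv_mem_S hs
  have hn : P.pi [y, P.inv s] ∈ pgKer P P' β := by
    have := hβ.map_mul_congr (h.mul_S_mem y hsi) (h.mul_S_mem s hsi) e rfl
    rw [hP.pi_mul_inv, hβ.map_one (hP.append_left [] [y] (hP.singleton_mem y))] at this
    exact this
  have := h.step_mul (Step.of_mem_center h.S_mem_delta (hker hn))
    (h.step_of_mem h.S_mem_delta hs)
  rwa [h.assoc_S_S_right y hsi hs, hP.pi_inv_mul, hP.pi_mul_one] at this

/-- If `f` carries `A` to `B` and `x ∈ S` normalizes `A` with `x ^ f ∈ S`, then conjugation by `f`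
is defined on some member of `Δ` containing both `A` and `x`. -/
theorem exists_step_extension (h : IsLocality p P Δ S) (hf : Step P Δ A f B)
    (hx : Step P Δ A x A) (hxS : x ∈ S) (hxf : P.conj x f ∈ S) :
    ∃ C E, Step P Δ C f E ∧ A ⊆ C ∧ x ∈ C := by
  have hP := h.isPartialGroup
  let A' : Δ := ⟨A, hf.source_mem⟩
  let B' : Δ := ⟨B, hf.target_mem⟩
  have hf' : Step P Δ A' f B' := hf
  let c : h.Normalizer A' →* h.Normalizer B' := Normalizer.conjHom hf'
  let K : Subgroup (h.Normalizer A') := Normalizer.ofIsSubgroup h A' h.isSubgroup_S ⊓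
    (Normalizer.ofIsSubgroup h B' h.isSubgroup_S).comap c
  have hAS := (h.delta_subgroups A hf.source_mem).2
  have hBS := (h.delta_subgroups B hf.target_mem).2
  have hAK : A ⊆ Normalizer.val '' (K : Set (h.Normalizer A')) := fun a ha =>
    ⟨⟨a, h.step_of_mem hf.source_mem ha⟩, ⟨hAS ha, hBS (hf.conj_mem ha)⟩, rfl⟩
  have heq : P.conjSet (Normalizer.val '' (K : Set (h.Normalizer A'))) f =
      Normalizer.val '' (K.map c : Set (h.Normalizer B')) := by
    rw [Data.conjSet, Subgroup.coe_map, Set.image_image, Set.image_image]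
    rfl
  refine ⟨Normalizer.val '' (K : Set (h.Normalizer A')), _, ⟨?_, ?_, ?_, rfl⟩, hAK,
    ⟨⟨x, hx⟩, ⟨hxS, hxf⟩, rfl⟩⟩
  · refine h.mem_delta_of_step (hf.symm hP) (Normalizer.isSubgroup_image K) ?_ hAK
    rintro _ ⟨a, ha, rfl⟩
    exact ha.1
  · rw [heq]
    refine h.mem_delta_of_step hf (Normalizer.isSubgroup_image _) ?_ ?_
    · rintro _ ⟨_, ⟨a, ha, rfl⟩, rfl⟩
      exact ha.2
    · rw [← heq, ← hf.conjSet_eq]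
      exact Set.image_mono hAK
  · rintro _ ⟨a, -, rfl⟩
    exact h.mem_D ((hf.symm hP).chain.append (a.step.chain.append hf.chain))

theorem step_of_mem_normalizer (h : IsLocality p P Δ S) (hA : A ∈ Δ)
    {x : h.Normalizer ⟨S, h.S_mem_delta⟩} (hx : x.val ∈ S)
    (hxn : x ∈ Subgroup.normalizer (Normalizer.ofIsSubgroup h ⟨S, h.S_mem_delta⟩
      (h.delta_subgroups A hA).1 : Set (h.Normalizer ⟨S, h.S_mem_delta⟩))) :
    Step P Δ A x.val A := by
  have hxA := h.step_conjSet hA hx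
  suffices P.conjSet A x.val = A by rwa [this] at hxA
  have hAS := (h.delta_subgroups A hA).2
  have key : ∀ (a : L) (ha : a ∈ S), a ∈ A ↔ P.conj a x.val ∈ A := by
    intro a ha
    have := Subgroup.mem_normalizer_iff''.1 hxn ⟨a, h.step_of_mem h.S_mem_delta ha⟩
    rwa [Normalizer.mem_ofIsSubgroup, Normalizer.mem_ofIsSubgroup, Normalizer.val_conj] at this
  apply Set.Subset.antisymm
  · rintro _ ⟨a, ha, rfl⟩
    exact (key a (hAS ha)).1 ha
  · intro a ha
    obtain ⟨b, hb, rfl⟩ := x.step.conjSet_eq.superset (hAS ha)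
    exact ⟨b, (key b hb).2 ha, rfl⟩

theorem exists_step_fiberStabilizer [Fact p.Prime] (h : IsLocality p P Δ S) (hβ : IsHom P P' β)
    (hker : pgKer P P' β ⊆ P.center) (f : L) :
    ∃ B, Step P Δ (Normalizer.val '' (h.fiberStabilizer hβ f :
      Set (h.Normalizer ⟨S, h.S_mem_delta⟩))) f B := by
  have := h.finite
  obtain ⟨A, ⟨B, hf⟩, hmax⟩ := (Set.toFinite {A | ∃ B, Step P Δ A f B}).exists_maximal
    (h.exists_step f)
  have hAs := h.delta_subgroups A hf.source_mem
  let A₀ := Normalizer.ofIsSubgroup h ⟨S, h.S_mem_delta⟩ hAs.1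
  have hle : A₀ ≤ h.fiberStabilizer hβ f := fun x hx => h.mem_fiberStabilizer_of_step hβ hf hx
  obtain heq | hlt := hle.eq_or_lt
  · refine ⟨B, ?_⟩
    convert hf
    rw [← heq]
    ext a
    constructor
    · rintro ⟨a, ha, rfl⟩
      exact ha
    · exact fun ha => ⟨⟨a, h.step_of_mem h.S_mem_delta (hAs.2 ha)⟩, ha, rfl⟩
  · exfalso
    have hRS : h.fiberStabilizer hβ f ≤
        Normalizer.ofIsSubgroup h ⟨S, h.S_mem_delta⟩ h.isSubgroup_S := fun x hx => hx.1
    have hRp := Normalizer.isPGroup_ofIsSubgroup.to_le hRS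
    obtain ⟨x, hxR, hxA, hxn⟩ := exists_mem_normalizer_of_isPGroup hRp hlt
    obtain ⟨k, hk⟩ := hRp ⟨x, hxR⟩
    obtain ⟨hxS, s, hs, e⟩ := hxR
    have hstep := h.step_of_mem_normalizer hf.source_mem hxS hxn
    have hyS := h.step_S_of_map_eq hβ hker hs (h.map_conj_eq hβ hf hstep hs e)
    have hf' : Step P Δ (⟨A, hf.source_mem⟩ : Δ) f (⟨B, hf.target_mem⟩ : Δ) := hf
    have hx1 : (⟨x.val, hstep⟩ : h.Normalizer ⟨A, hf.source_mem⟩) ^ p ^ k = 1 :=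
      Normalizer.pow_eq_one_of_val_eq (A := ⟨S, h.S_mem_delta⟩) (B := ⟨A, hf.source_mem⟩) (a := x)
        rfl (congrArg Subtype.val hk)
    have hy1 := congrArg (Normalizer.conjHom hf') hx1
    rw [map_pow, map_one] at hy1
    have hy2 : (⟨_, hyS⟩ : h.Normalizer ⟨S, h.S_mem_delta⟩) ^ p ^ k = 1 :=
      Normalizer.pow_eq_one_of_val_eq (by rfl) hy1
    obtain ⟨C, E, hC, hAC, hxC⟩ := h.exists_step_extension hf hstep hxS
      (Normalizer.mem_of_pow_eq_one _ hy2)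
    exact hxA (hmax ⟨E, hC⟩ hAC hxC)

/-- Elements with the same image differ by an element of the kernel. -/
theorem exists_mem_ker_of_map_eq [Fact p.Prime] (h : IsLocality p P Δ S) (hβ : IsHom P P' β)
    (hker : pgKer P P' β ⊆ P.center) (hfg : β f = β g) :
    ∃ n ∈ pgKer P P' β, g = P.pi [f, n] := by
  have hP := h.isPartialGroup
  obtain ⟨B, hf⟩ := h.exists_step_fiberStabilizer hβ hker f
  obtain ⟨C, hg⟩ := h.exists_step_fiberStabilizer hβ hker g
  rw [← h.fiberStabilizer_congr hβ hfg] at hg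
  have hfi := hf.symm hP
  refine ⟨P.pi [P.inv f, g], ?_, ?_⟩
  · have := hβ.map_mul_congr (h.mem_D (hfi.chain.append hf.chain))
      (h.mem_D (hfi.chain.append hg.chain)) rfl hfg
    rw [hP.pi_inv_mul, hβ.map_one (hP.append_left [] [f] (hP.singleton_mem f))] at this
    exact this.symm
  · rw [← h.pi_pi_left hf hfi hg, hP.pi_mul_inv, hP.pi_one_mul]

theorem chain_of_map_eq [Fact p.Prime] (h : IsLocality p P Δ S) (hβ : IsHom P P' β)
    (hker : pgKer P P' β ⊆ P.center) {u v : List L} (hu : Chain P Δ A u B)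
    (huv : u.map β = v.map β) : Chain P Δ A v B := by
  induction u generalizing A v with
  | nil =>
    obtain rfl : v = [] := by simpa using huv.symm
    exact hu
  | cons f u ih =>
    obtain ⟨g, v, rfl⟩ : ∃ g w, v = g :: w :=
      List.exists_cons_of_ne_nil (by rintro rfl; simp at huv)
    simp only [List.map_cons, List.cons.injEq] at huv
    obtain ⟨C, hf, hu⟩ := hu
    obtain ⟨n, hn, rfl⟩ := h.exists_mem_ker_of_map_eq hβ hker huv.1
    exact ⟨C, h.step_mul hf (Step.of_mem_center hf.target_mem (hker hn)), ih hu huv.2⟩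

end Fiber

theorem center_mul_mem (h : IsLocality p P Δ S) {n : L} (hn : n ∈ P.center) (f : L) :
    [n, f] ∈ P.D := by
  obtain ⟨A, B, hf⟩ := h.exists_step f
  exact h.mem_D ((Step.of_mem_center hf.source_mem hn).chain.append hf.chain)

theorem ncard_rightCoset (h : IsLocality p P Δ S) {N : Set L} (hN : N ⊆ P.center) (f : L) :
    (rightCoset P N f).ncard = N.ncard := by
  have heq : rightCoset P N f = (fun n => P.pi [n, f]) '' N := by
    ext y
    exact exists_congr fun n => and_congr_right fun hn =>
      and_iff_right (h.center_mul_mem (hN hn) f)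
  rw [heq]
  refine Set.InjOn.ncard_image fun m hm n hn e => ?_
  have hP := h.isPartialGroup
  rw [← hP.pi_mul_mul_inv (h.center_mul_mem (hN hm) f),
    ← hP.pi_mul_mul_inv (h.center_mul_mem (hN hn) f)]
  exact congrArg (fun z => P.pi [z, P.inv f]) e

end IsLocality

/-- Lemma 3.9: if `(L,Δ,S)` is a locality, `L'` a partial group, and `β : L → L'` a
projection of partial groups with `N := ker(β) ⊆ Z(L)`, then every right coset of
`N` has exactly `|N|` elements and is therefore maximal among the right cosets of
`N`; moreover `v ∈ D` if and only if `vβ* ∈ D'` for every word `v ∈ W(L)`. -/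
theorem coset_modCentral (p : ℕ) (hp : p.Prime) (P : Data L) (Δ : Set (Set L))
    (S : Set L) (hloc : IsLocality p P Δ S) (P' : Data L') (hP' : IsPartialGroup P')
    (β : L → L') (hβ : IsProjection P P' β) (hker : pgKer P P' β ⊆ P.center) :
    (∀ f : L, (rightCoset P (pgKer P P' β) f).ncard = (pgKer P P' β).ncard) ∧
    (∀ f g : L, rightCoset P (pgKer P P' β) f ⊆ rightCoset P (pgKer P P' β) g →
      rightCoset P (pgKer P P' β) f = rightCoset P (pgKer P P' β) g) ∧
    (∀ v : List L, v ∈ P.D ↔ v.map β ∈ P'.D) := by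
  have : Fact p.Prime := ⟨hp⟩
  have := hloc.finite
  have hcard := hloc.ncard_rightCoset hker
  refine ⟨hcard, fun f g hfg => ?_, fun v => ⟨hβ.1.1 v, fun hv => ?_⟩⟩
  · exact Set.eq_of_subset_of_ncard_le hfg (by rw [hcard, hcard])
  · obtain ⟨u, hu, huv⟩ := hβ.2 _ hv
    obtain ⟨A, B, hu⟩ := hloc.exists_chain hu
    exact hloc.mem_D (hloc.chain_of_map_eq hβ.1 hker hu huv)

end PartialGroups
end
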